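/- arXiv:2008.06013 — 3 statements merged into one kernel-verified Lean document; each statement's English description precedes it below -/
import Mathlib

section
/- Let k ≥ 2 and d ≥ 2 be integers, and let A_k = {n^k : n ∈ ℤ} ⊆ ℝ and B_k = {C(n,k) : n ∈ ℕ} ⊆ ℝ, where C(n,k) is the binomial coefficient. Then no natural number is a Helly bound for A_k^d ⊆ ℝ^d, and no natural number is a Helly bound for B_k^d ⊆ ℝ^d. (In other words, H(A_k^d) = H(B_k^d) = ∞.) -/
/-- `h` is a Helly bound for `S ⊆ ℝ^N`: for every finite family `F` of convex sets in
`ℝ^N`, if the intersection of every subfamily of at most `h` members of `F` contains a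
point of `S`, then the intersection of all members of `F` contains a point of `S`. -/
def HellyBound (N : ℕ) (S : Set (Fin N → ℝ)) (h : ℕ) : Prop :=
  ∀ F : Finset (Set (Fin N → ℝ)), (∀ A ∈ F, Convex ℝ A) →
    (∀ G ⊆ F, G.card ≤ h → ∃ p ∈ S, ∀ A ∈ G, p ∈ A) →
    ∃ p ∈ S, ∀ A ∈ F, p ∈ A

/-- A Helly bound `N` is refuted by `N + 1` convex sets with no common point of `S`, such that
omitting any one of them leaves a common point of `S`. -/
theorem not_hellyBound_of_critical {d N : ℕ} {S : Set (Fin d → ℝ)}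
    (A : ℕ → Set (Fin d → ℝ)) (p : ℕ → Fin d → ℝ)
    (hconv : ∀ i, Convex ℝ (A i)) (hpS : ∀ i, p i ∈ S) (hself : ∀ i, p i ∉ A i)
    (hmem : ∀ i ≤ N, ∀ j, i ≠ j → p i ∈ A j)
    (hempty : ∀ q ∈ S, ∃ i ≤ N, q ∉ A i) : ¬ HellyBound d S N := by
  classical
  intro H
  have hinj : Set.InjOn A (Finset.range (N + 1)) := by
    intro i hi j _ hij
    by_contra hne
    have hi' : i ≤ N := by simpa [Nat.lt_succ_iff] using hi
    exact hself i (hij ▸ hmem i hi' j hne)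
  obtain ⟨q, hqS, hq⟩ := H ((Finset.range (N + 1)).image A)
    (by
      intro B hB
      obtain ⟨i, -, rfl⟩ := Finset.mem_image.1 hB
      exact hconv i)
    (by
      intro G hG hcard
      obtain ⟨B, hB, hBG⟩ : ∃ B ∈ (Finset.range (N + 1)).image A, B ∉ G := by
        by_contra! hall
        have := Finset.card_le_card (show (Finset.range (N + 1)).image A ⊆ G from hall)
        rw [Finset.card_image_of_injOn hinj, Finset.card_range] at this
        omega
      obtain ⟨i, hi, rfl⟩ := Finset.mem_image.1 hB
      refine ⟨p i, hpS i, fun C hC => ?_⟩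
      obtain ⟨j, -, rfl⟩ := Finset.mem_image.1 (hG hC)
      refine hmem i (Nat.lt_succ_iff.1 (Finset.mem_range.1 hi)) j ?_
      rintro rfl
      exact hBG hC)
  obtain ⟨i, hi, hqi⟩ := hempty q hqS
  exact hqi (hq _ (Finset.mem_image_of_mem A (Finset.mem_range.2 (Nat.lt_succ_iff.2 hi))))

/-- If `a` is a strictly increasing enumeration of `T ∩ [a 0, ∞)` and the points `(a i, a (i + 1))`
lie on a strictly concave curve (with supporting slopes `s i`), then `T ^ d` has no Helly bound. -/
theorem not_hellyBound_pi_of_concave {d : ℕ} (hd : 2 ≤ d) {T : Set ℝ} (a s : ℕ → ℝ)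
    (ha : StrictMono a) (haT : ∀ i, a i ∈ T) (hT : ∀ x ∈ T, a 0 ≤ x → ∃ i, x = a i)
    (hs : ∀ i j, j ≠ i → a (j + 1) < a (i + 1) + s i * (a j - a i)) (N : ℕ) :
    ¬ HellyBound d {z | ∀ i, z i ∈ T} N := by
  let e₀ : Fin d := ⟨0, by omega⟩
  let e₁ : Fin d := ⟨1, by omega⟩
  have he : e₁ ≠ e₀ := by simp [e₀, e₁]
  refine not_hellyBound_of_critical
    (fun i => {z | a 0 ≤ z e₀ ∧ z e₀ ≤ a N ∧ z e₀ < z e₁ ∧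
      z e₁ < a (i + 1) + s i * (z e₀ - a i)})
    (fun i e => if e = e₀ then a i else a (i + 1)) ?_ ?_ ?_ ?_ ?_
  · intro i
    rintro x ⟨hx₁, hx₂, hx₃, hx₄⟩ y ⟨hy₁, hy₂, hy₃, hy₄⟩ u v hu hv huv
    obtain rfl : v = 1 - u := by linarith
    simp only [Set.mem_ofPred_eq, Pi.add_apply, Pi.smul_apply, smul_eq_mul]
    have strict : ∀ b c : ℝ, 0 < b → 0 < c → 0 < u * b + (1 - u) * c := by
      intro b c hb hc
      rcases hu.eq_or_lt with rfl | hu'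
      · simpa using hc
      · have := mul_pos hu' hb
        have := mul_nonneg hv hc.le
        linarith
    have h₃ := strict _ _ (sub_pos.2 hx₃) (sub_pos.2 hy₃)
    have h₄ := strict _ _ (sub_pos.2 hx₄) (sub_pos.2 hy₄)
    refine ⟨?_, ?_, ?_, ?_⟩
    · nlinarith
    · nlinarith
    · linarith
    · linarith
  · intro i e
    dsimp only
    split_ifs
    exacts [haT _, haT _]
  · rintro i ⟨-, -, -, h⟩
    simp [he] at h
  · intro i hi j hij
    simp only [Set.mem_ofPred_eq, if_true, if_neg he]
    exact ⟨ha.monotone (Nat.zero_le i), ha.monotone hi, ha (Nat.lt_succ_self i), hs j i hij⟩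
  · intro q hq
    by_contra! hall
    have h₀ := hall 0 (Nat.zero_le N)
    obtain ⟨j, hj⟩ := hT _ (hq e₀) h₀.1
    obtain ⟨l, hl⟩ := hT _ (hq e₁) (h₀.1.trans h₀.2.2.1.le)
    have hjN : j ≤ N := ha.le_iff_le.1 (hj ▸ h₀.2.1)
    obtain ⟨-, -, h₁, h₂⟩ := hall j hjN
    rw [hj, hl] at h₁ h₂
    rw [sub_self, mul_zero, add_zero] at h₂
    have := ha.lt_iff_lt.1 h₁
    have := ha.lt_iff_lt.1 h₂
    omega

theorem add_one_pow_lt_of_ne {k : ℕ} (hk : 2 ≤ k) {x y : ℝ} (hx : 0 < x) (hy : 0 < y)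
    (hne : y ≠ x) :
    (y + 1) ^ k < (x + 1) ^ k + (x + 1) ^ (k - 1) / x ^ (k - 1) * (y ^ k - x ^ k) := by
  obtain ⟨k, rfl⟩ : ∃ m, k = m + 1 := ⟨k - 1, by omega⟩
  have hyx : y / x ≠ 1 := by rwa [Ne, div_eq_one_iff_eq hx.ne']
  have hy' : y / x ∈ Set.Ici (0 : ℝ) := Set.mem_Ici.2 (by positivity)
  have hweights : x / (x + 1) + 1 / (x + 1) = 1 := by field_simp
  have h := (strictConvexOn_pow hk).2 hy' (Set.mem_Ici.2 zero_le_one) hyx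
    (by positivity) (by positivity) hweights
  simp only [smul_eq_mul] at h
  have e₁ : x / (x + 1) * (y / x) + 1 / (x + 1) * 1 = (y + 1) / (x + 1) := by field_simp
  rw [e₁, div_pow, div_lt_iff₀ (by positivity)] at h
  refine h.trans_eq ?_
  rw [Nat.add_sub_cancel, one_pow, div_pow]
  field_simp
  ring

/-- A sequence strictly increasing up to `i` and strictly decreasing from `i` on has its strict
maximum at `i`. -/
theorem lt_of_increments_sign {g : ℕ → ℝ} {i : ℕ} (hlt : ∀ j < i, g j < g (j + 1))
    (hge : ∀ j, i ≤ j → g (j + 1) < g j) {j : ℕ} (hne : j ≠ i) : g j < g i := by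
  rcases lt_or_gt_of_ne hne with h | h
  · exact strictMonoOn_Iic_of_lt_succ (n := i) hlt h.le (Set.mem_Iic.2 le_rfl) h
  · induction j, h using Nat.le_induction with
    | base => exact hge i le_rfl
    | succ j hj ih => exact (hge j (by omega)).trans (ih (by omega))

theorem choose_succ_lt_of_ne {k : ℕ} (hk : 2 ≤ k) {i j : ℕ} (hne : j ≠ i) :
    ((j + 1 + k).choose k : ℝ) < ((i + 1 + k).choose k : ℝ) +
      (1 + (k - 1) / (i + 3 / 2)) * ((j + k).choose k - (i + k).choose k) := by
  obtain ⟨k, rfl⟩ : ∃ m, k = m + 1 := ⟨k - 1, by omega⟩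
  have hk' : (0 : ℝ) < k := by exact_mod_cast (by omega : 0 < k)
  push_cast
  rw [add_sub_cancel_right]
  set s : ℝ := 1 + k / (i + 3 / 2) with hs
  let g : ℕ → ℝ := fun j =>
    ((j + 1 + (k + 1)).choose (k + 1) : ℝ) - s * (j + (k + 1)).choose (k + 1)
  have pascal : ∀ j : ℕ, ((j + 1 + (k + 1)).choose (k + 1) : ℝ) =
      (j + (k + 1)).choose k + (j + (k + 1)).choose (k + 1) := by
    intro j
    rw [show j + 1 + (k + 1) = (j + (k + 1)) + 1 by ring, Nat.choose_succ_succ]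
    push_cast; rfl
  have step : ∀ j : ℕ, g (j + 1) - g j =
      (k / (j + 2) - k / (i + 3 / 2)) * ((j + (k + 1)).choose k : ℝ) := by
    intro j
    have hmul : ((j + 1 + (k + 1)).choose k : ℝ) * (j + 2) =
        (j + k + 2) * (j + (k + 1)).choose k := by
      have := Nat.choose_mul_succ_eq (j + (k + 1)) k
      rw [show j + (k + 1) + 1 - k = j + 2 by omega,
        show j + (k + 1) + 1 = j + 1 + (k + 1) by ring] at this
      have : ((j + (k + 1)).choose k : ℝ) * (j + 1 + (k + 1)) =
          (j + 1 + (k + 1)).choose k * (j + 2) := by exact_mod_cast this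
      linarith
    have hratio : ((j + 1 + (k + 1)).choose k : ℝ) =
        (1 + k / (j + 2)) * (j + (k + 1)).choose k := by
      field_simp
      linarith
    simp only [g]
    rw [pascal (j + 1), hratio, pascal j, hs]
    ring
  have hpos : ∀ j : ℕ, (0 : ℝ) < ((j + (k + 1)).choose k : ℝ) := fun j => by
    exact_mod_cast Nat.choose_pos (by omega)
  have := lt_of_increments_sign (g := g) (i := i)
    (fun j hj => by
      have hj' : (j : ℝ) + 1 ≤ i := by exact_mod_cast hj
      rw [← sub_pos, step]
      refine mul_pos (sub_pos.2 (div_lt_div_of_pos_left hk' (by positivity) (by linarith))) (hpos j))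
    (fun j hj => by
      have hj' : (i : ℝ) ≤ j := by exact_mod_cast hj
      rw [← sub_neg, step]
      refine mul_neg_of_neg_of_pos
        (sub_neg.2 (div_lt_div_of_pos_left hk' (by positivity) (by linarith))) (hpos j)) hne
  simp only [g] at this
  linarith

/-- For `k, d ≥ 2`, the sets `A_k = {n^k : n ∈ ℤ}` and `B_k = {C(n,k) : n ∈ ℕ}` satisfy
`H(A_k^d) = H(B_k^d) = ∞`: no natural number is a Helly bound for `A_k^d` or `B_k^d`. -/
theorem powers_and_binomials_infinite_helly (k d : ℕ) (hk : 2 ≤ k) (hd : 2 ≤ d) :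
    (∀ N : ℕ,
      ¬ HellyBound d {z : Fin d → ℝ | ∀ i, ∃ n : ℤ, z i = (n : ℝ) ^ k} N) ∧
    (∀ N : ℕ,
      ¬ HellyBound d {z : Fin d → ℝ | ∀ i, ∃ n : ℕ, z i = (Nat.choose n k : ℝ)} N) := by
  constructor
  · refine not_hellyBound_pi_of_concave hd (T := {x | ∃ n : ℤ, x = (n : ℝ) ^ k})
      (fun i => ((i : ℝ) + 1) ^ k)
      (fun i => ((i : ℝ) + 1 + 1) ^ (k - 1) / ((i : ℝ) + 1) ^ (k - 1)) ?_ ?_ ?_ ?_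
    · intro i j hij
      have : (i : ℝ) < j := by exact_mod_cast hij
      exact pow_lt_pow_left₀ (by linarith) (by positivity) (by omega)
    · exact fun i => ⟨i + 1, by push_cast; rfl⟩
    · rintro x ⟨n, rfl⟩ hn
      simp only [Nat.cast_zero, zero_add, one_pow] at hn
      have hn0 : n.natAbs ≠ 0 := by
        intro h
        rw [Int.natAbs_eq_zero.1 h, Int.cast_zero, zero_pow (by omega)] at hn
        linarith
      obtain ⟨m, hm⟩ := Nat.exists_eq_succ_of_ne_zero hn0
      refine ⟨m, ?_⟩
      have hcast : (m : ℝ) + 1 = |(n : ℝ)| := by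
        rw [← Int.cast_abs, Int.abs_eq_natAbs, hm]
        push_cast; rfl
      rw [hcast, ← abs_pow, abs_of_nonneg (by linarith)]
    · intro i j hij
      have hne : (j : ℝ) + 1 ≠ i + 1 := by simpa using hij
      simpa using add_one_pow_lt_of_ne hk (by positivity) (by positivity) hne
  · refine not_hellyBound_pi_of_concave hd (T := {x | ∃ n : ℕ, x = (n.choose k : ℝ)})
      (fun i => ((i + k).choose k : ℝ)) (fun i => 1 + ((k : ℝ) - 1) / (i + 3 / 2)) ?_ ?_ ?_ ?_
    · refine strictMono_nat_of_lt_succ fun i => ?_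
      have : (i + k).choose k < (i + 1 + k).choose k := by
        obtain ⟨k, rfl⟩ : ∃ m, k = m + 1 := ⟨k - 1, by omega⟩
        rw [show i + 1 + (k + 1) = (i + (k + 1)) + 1 by ring, Nat.choose_succ_succ]
        exact Nat.lt_add_of_pos_left (Nat.choose_pos (by omega))
      exact_mod_cast this
    · exact fun i => ⟨i + k, rfl⟩
    · rintro x ⟨n, rfl⟩ hn
      have hkn : k ≤ n := by
        by_contra! h
        rw [Nat.choose_eq_zero_of_lt h] at hn
        simp at hn
        linarith
      exact ⟨n - k, by simp only [Nat.sub_add_cancel hkn]⟩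
    · exact fun i j hij => choose_succ_lt_of_ne hk hij
end

section
/- There exists a set A ⊆ ℤ such that consecutive elements of A differ by at most 2 (equivalently, for every m ∈ ℤ the interval [m, m+2] contains an element of A) and such that for every integer d ≥ 2, no natural number is a Helly bound for A^d ⊆ ℝ^d: for every N ∈ ℕ there exists a finite family F of convex sets in ℝ^d such that the intersection of every subfamily of at most N members of F contains a point of A^d, but the intersection of all members of F contains no point of A^d. (In other words, there is a 2-syndetic set A ⊆ ℤ with H(A^d) = ∞ for every d ≥ 2.) -/
/-- The second coordinate of the image of the lattice point `(s, t)` under the `n`-th unimodular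
affine map; the images of the boxes `[0, n] × [0, n²]` for different `n` are far apart. -/
def boxHeight (n s t : ℕ) : ℕ := 10 * n ^ 4 + (3 * n ^ 2 + 4) * s + 3 * t

theorem boxHeight_add_two_le_of_level_lt {n m s t s' t' : ℕ} (hs : s ≤ n) (ht : t ≤ n ^ 2)
    (h : n < m) : boxHeight n s t + 2 ≤ boxHeight m s' t' := by
  have h1 : (n + 1) ^ 4 ≤ m ^ 4 := Nat.pow_le_pow_left h 4
  have h2 : (3 * n ^ 2 + 4) * s ≤ (3 * n ^ 2 + 4) * n := Nat.mul_le_mul_left _ hs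
  have h3 : 0 ≤ (3 * m ^ 2 + 4) * s' := Nat.zero_le _
  unfold boxHeight
  ring_nf at *
  nlinarith

theorem boxHeight_add_two_le_of_lt {n s t s' t' : ℕ} (ht : t ≤ n ^ 2) (h : s < s') :
    boxHeight n s t + 2 ≤ boxHeight n s' t' := by
  have h1 : (3 * n ^ 2 + 4) * (s + 1) ≤ (3 * n ^ 2 + 4) * s' := Nat.mul_le_mul_left _ h
  unfold boxHeight
  linarith

theorem boxHeight_separated {n m s t s' t' : ℕ} (hs : s ≤ n) (ht : t ≤ n ^ 2)
    (hs' : s' ≤ m) (ht' : t' ≤ m ^ 2) (h₁ : boxHeight n s t ≤ boxHeight m s' t')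
    (h₂ : boxHeight m s' t' ≤ boxHeight n s t + 1) : n = m ∧ s = s' ∧ t = t' := by
  rcases lt_trichotomy n m with h | rfl | h
  · have := boxHeight_add_two_le_of_level_lt (s' := s') (t' := t') hs ht h
    omega
  · rcases lt_trichotomy s s' with h | rfl | h
    · have := boxHeight_add_two_le_of_lt (t' := t') ht h
      omega
    · refine ⟨rfl, rfl, ?_⟩
      unfold boxHeight at h₁ h₂
      omega
    · have := boxHeight_add_two_le_of_lt (t' := t) ht' h
      omega
  · have := boxHeight_add_two_le_of_level_lt (s' := s) (t' := t) hs' ht' h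
    omega

/-- The integers that are not heights of box points off the parabola `t = s²`. -/
def parabolaSet : Set ℤ :=
  {y | ∀ n s t : ℕ, s ≤ n → t ≤ n ^ 2 → y = boxHeight n s t → t = s ^ 2}

theorem mem_parabolaSet_of_nonpos {y : ℤ} (hy : y ≤ 0) : y ∈ parabolaSet := by
  intro n s t hs ht h
  have h0 : boxHeight n s t = 0 := by omega
  have hn : n = 0 := by
    by_contra hn
    have : 0 < n ^ 4 := by positivity
    unfold boxHeight at h0
    omega
  subst hn
  obtain rfl : s = 0 := by omega
  simpa using ht

theorem boxHeight_mem_parabolaSet {n k : ℕ} (hk : k ≤ n) :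
    (boxHeight n k (k ^ 2) : ℤ) ∈ parabolaSet := by
  intro m s t hs ht h
  have h' : boxHeight n k (k ^ 2) = boxHeight m s t := by exact_mod_cast h
  obtain ⟨-, rfl, rfl⟩ :=
    boxHeight_separated hk (Nat.pow_le_pow_left hk 2) hs ht h'.le (by omega)
  rfl

theorem mem_parabolaSet_or_add_one_mem (m : ℤ) : m ∈ parabolaSet ∨ m + 1 ∈ parabolaSet := by
  by_contra! h
  obtain ⟨h₁, h₂⟩ := h
  simp only [parabolaSet, Set.mem_ofPred_eq, not_forall] at h₁ h₂
  obtain ⟨n, s, t, hs, ht, h, hne⟩ := h₁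
  obtain ⟨n', s', t', hs', ht', h', hne'⟩ := h₂
  obtain ⟨rfl, rfl, rfl⟩ := boxHeight_separated hs ht hs' ht' (by omega) (by omega)
  omega

/-- A family of `h + 1` convex sets with no common point in `S`, such that omitting any one
member leaves a common point in `S`, shows that `h` is not a Helly bound for `S`. -/
theorem not_hellyBound_of_critical_family {N h : ℕ} {S : Set (Fin N → ℝ)}
    (C : Fin (h + 1) → Set (Fin N → ℝ)) (p : Fin (h + 1) → Fin N → ℝ)
    (hC : ∀ k, Convex ℝ (C k)) (hpS : ∀ k, p k ∈ S) (hp : ∀ j k, j ≠ k → p k ∈ C j)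
    (hS : ∀ z ∈ S, ∃ k, z ∉ C k) : ¬ HellyBound N S h := by
  classical
  intro H
  have hnot : ∀ k, p k ∉ C k := by
    intro k hk
    obtain ⟨j, hj⟩ := hS (p k) (hpS k)
    by_cases hjk : j = k
    · exact hj (hjk ▸ hk)
    · exact hj (hp j k hjk)
  have hinj : Function.Injective C := by
    intro j k hjk
    by_contra hne
    exact hnot k (hjk ▸ hp j k hne)
  obtain ⟨z, hzS, hz⟩ := H (Finset.univ.image C)
    (by simpa using hC) (by
      intro G hG hcard
      obtain ⟨k, hk⟩ : ∃ k, C k ∉ G := by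
        by_contra! hall
        have hsub : Finset.univ.image C ⊆ G := by
          simpa [Finset.subset_iff] using hall
        have := Finset.card_le_card hsub
        rw [Finset.card_image_of_injective _ hinj, Finset.card_fin] at this
        omega
      refine ⟨p k, hpS k, fun B hB => ?_⟩
      obtain ⟨j, -, rfl⟩ := Finset.mem_image.1 (hG hB)
      exact hp j k fun hjk => hk (hjk ▸ hB))
  obtain ⟨k, hk⟩ := hS z hzS
  exact hk (hz _ (Finset.mem_image_of_mem C (Finset.mem_univ k)))

/-- In the coordinates `s = y - 10n⁴ + 3x`, `t = -x - (n² + 1)s`, the part of the box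
`[0, n] × [0, n²]` lying above a line that separates `(k, k²)` from the other integer points
of the parabola `t = s²`. -/
def cutBox (n : ℕ) (k x y : ℝ) : Prop :=
  let s : ℝ := y - 10 * n ^ 4 + 3 * x
  let t : ℝ := -x - (n ^ 2 + 1) * s
  0 ≤ s ∧ s ≤ n ∧ 0 ≤ t ∧ t ≤ n ^ 2 ∧ 1 ≤ t - 2 * k * s + k ^ 2

theorem convex_setOf_cutBox {d : ℕ} (n : ℕ) (k : ℝ) (i j : Fin d) :
    Convex ℝ {z : Fin d → ℝ | cutBox n k (z i) (z j)} := by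
  rintro u ⟨hu₁, hu₂, hu₃, hu₄, hu₅⟩ v ⟨hv₁, hv₂, hv₃, hv₄, hv₅⟩ a b ha hb hab
  obtain rfl : b = 1 - a := by linarith
  simp only [Set.mem_ofPred_eq, cutBox, Pi.add_apply, Pi.smul_apply, smul_eq_mul]
  refine ⟨?_, ?_, ?_, ?_, ?_⟩
  · linear_combination a * hu₁ + (1 - a) * hv₁
  · linear_combination a * hu₂ + (1 - a) * hv₂
  · linear_combination a * hu₃ + (1 - a) * hv₃
  · linear_combination a * hu₄ + (1 - a) * hv₄
  · linear_combination a * hu₅ + (1 - a) * hv₅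

theorem cutBox_of_ne {n j k : ℕ} (hk : k ≤ n) (hjk : j ≠ k) :
    cutBox n j ((-((n ^ 2 + 1) * k + k ^ 2 : ℕ) : ℤ) : ℝ)
      ((boxHeight n k (k ^ 2) : ℤ) : ℝ) := by
  have hk' : (k : ℝ) ≤ n := by exact_mod_cast hk
  have hsq : (1 : ℝ) ≤ ((k : ℝ) - j) ^ 2 := by
    have h : (1 : ℤ) ≤ ((k : ℤ) - j) ^ 2 := by
      have : (k : ℤ) - j ≠ 0 := by omega
      have : 0 < ((k : ℤ) - j) ^ 2 := by positivity
      omega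
    exact_mod_cast h
  have hk2 : (k : ℝ) ^ 2 ≤ n ^ 2 := by gcongr
  have hk0 : (0 : ℝ) ≤ k := k.cast_nonneg
  have hs : ((boxHeight n k (k ^ 2) : ℤ) : ℝ) - 10 * n ^ 4
      + 3 * ((-((n ^ 2 + 1) * k + k ^ 2 : ℕ) : ℤ) : ℝ) = k := by
    simp only [boxHeight]
    push_cast
    ring
  have ht : -((-((n ^ 2 + 1) * k + k ^ 2 : ℕ) : ℤ) : ℝ) - ((n : ℝ) ^ 2 + 1) * k = k ^ 2 := by
    push_cast
    ring
  simp only [cutBox, hs, ht]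
  refine ⟨hk0, hk', by positivity, hk2, by linarith⟩

theorem exists_not_cutBox (n : ℕ) {x y : ℤ} (hy : y ∈ parabolaSet) :
    ∃ k : Fin (n + 1), ¬ cutBox n (k : ℕ) x y := by
  by_contra! H
  obtain ⟨s, hs⟩ : ∃ s : ℤ, s = y - 10 * n ^ 4 + 3 * x := ⟨_, rfl⟩
  obtain ⟨t, ht⟩ : ∃ t : ℤ, t = -x - (n ^ 2 + 1) * s := ⟨_, rfl⟩
  have key : ∀ k : Fin (n + 1), 0 ≤ s ∧ s ≤ n ∧ 0 ≤ t ∧ t ≤ n ^ 2 ∧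
      1 ≤ t - 2 * (k : ℕ) * s + (k : ℕ) ^ 2 := by
    intro k
    have := H k
    simp only [cutBox] at this
    rw [ht, hs]
    exact_mod_cast this
  obtain ⟨hs0, hsn, ht0, htn, -⟩ := key 0
  lift s to ℕ using hs0
  lift t to ℕ using ht0
  have hsn' : s ≤ n := by exact_mod_cast hsn
  have hts : t = s ^ 2 := by
    refine hy n s t hsn' (by exact_mod_cast htn) ?_
    simp only [boxHeight]
    push_cast
    linear_combination -hs - 3 * ht
  have h : 1 ≤ (t : ℤ) - 2 * s * s + s ^ 2 := (key ⟨s, by omega⟩).2.2.2.2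
  rw [hts] at h
  push_cast at h
  nlinarith

/-- There is a `2`-syndetic set `A ⊆ ℤ` (every interval `[m, m+2]` meets `A`, i.e.
consecutive elements differ by at most `2`) such that `H(A^d) = ∞` for every `d ≥ 2`:
no natural number is a Helly bound for `A^d ⊆ ℝ^d`. -/
theorem syndetic_set_infinite_helly :
    ∃ A : Set ℤ,
      (∀ m : ℤ, ∃ x ∈ A, m ≤ x ∧ x ≤ m + 2) ∧
      ∀ d : ℕ, 2 ≤ d → ∀ N : ℕ,
        ¬ HellyBound d {z : Fin d → ℝ | ∀ i, ∃ x ∈ A, z i = (x : ℝ)} N := by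
  refine ⟨parabolaSet, fun m => ?_, fun d hd n => ?_⟩
  · rcases mem_parabolaSet_or_add_one_mem m with h | h
    · exact ⟨m, h, le_rfl, by omega⟩
    · exact ⟨m + 1, h, by omega, by omega⟩
  · have hij : (⟨0, by omega⟩ : Fin d) ≠ ⟨1, by omega⟩ := by simp
    generalize (⟨0, _⟩ : Fin d) = i at hij
    generalize (⟨1, _⟩ : Fin d) = j at hij
    refine not_hellyBound_of_critical_family
      (fun k : Fin (n + 1) => {z | cutBox n (k : ℕ) (z i) (z j)})
      (fun k l => if l = j then ((boxHeight n k (k ^ 2) : ℤ) : ℝ)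
        else ((-((n ^ 2 + 1) * k + k ^ 2 : ℕ) : ℤ) : ℝ))
      (fun k => convex_setOf_cutBox n _ i j) (fun k l => ?_) (fun k l hkl => ?_) (fun z hz => ?_)
    · dsimp only
      split_ifs
      · exact ⟨_, boxHeight_mem_parabolaSet (by omega), rfl⟩
      · exact ⟨_, mem_parabolaSet_of_nonpos (by omega), rfl⟩
    · simp only [Set.mem_ofPred_eq, if_neg hij, if_true]
      exact cutBox_of_ne (by omega) (Fin.val_ne_of_ne hkl)
    · obtain ⟨x, -, hx⟩ := hz i
      obtain ⟨y, hy, hy'⟩ := hz j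
      simpa [hx, hy'] using exists_not_cutBox n (x := x) hy
end

section
/- Let P ⊆ ℝ denote the set of prime numbers. Then 12 is not a Helly bound for P × P ⊆ ℝ²: there exists a finite family F of convex sets in ℝ² such that the intersection of every subfamily of at most 12 members of F contains a point of P × P, but the intersection of all members of F contains no point of P × P. (In other words, H(P × P) ≥ 13.) -/
/-- First coordinates of the vertices, in cyclic order, of a convex 13-gon with prime coordinates. -/
def vertexX : Fin 13 → ℕ :=
  ![941, 937, 929, 919, 911, 887, 883, 881, 881, 883, 919, 937, 941]

/-- Second coordinates of the vertices of the 13-gon. -/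
def vertexY : Fin 13 → ℕ :=
  ![1229, 1231, 1237, 1249, 1259, 1291, 1297, 1301, 1303, 1301, 1259, 1237, 1231]

/-- Orientation determinant of `(x, y)` with respect to the line from the vertex before `i` to the
vertex after `i`; it is positive exactly on the side of the line that contains the vertex `i`. -/
def earDet {R : Type*} [CommRing R] (i : Fin 13) (x y : R) : R :=
  ((vertexX (i + 1) : R) - vertexX (i - 1)) * (y - vertexY (i - 1)) -
    ((vertexY (i + 1) : R) - vertexY (i - 1)) * (x - vertexX (i - 1))

/-- The closed half-plane cutting the vertex `i` off the 13-gon. -/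
def cutHalfPlane (i : Fin 13) : Set (Fin 2 → ℝ) := {z | earDet i (z 0) (z 1) ≤ 0}

theorem convex_cutHalfPlane (i : Fin 13) : Convex ℝ (cutHalfPlane i) := by
  intro z hz w hw s t hs ht hst
  simp only [cutHalfPlane, earDet, Set.mem_ofPred_eq, Pi.add_apply, Pi.smul_apply,
    smul_eq_mul] at *
  obtain rfl : t = 1 - s := by linarith
  nlinarith [mul_nonneg hs (neg_nonneg.2 hz), mul_nonneg ht (neg_nonneg.2 hw)]

theorem natCast_mem_cutHalfPlane_iff (i : Fin 13) (q r : ℕ) :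
    ![(q : ℝ), (r : ℝ)] ∈ cutHalfPlane i ↔ earDet i (q : ℤ) (r : ℤ) ≤ 0 := by
  rw [← Int.cast_nonpos (R := ℝ)]
  simp [cutHalfPlane, earDet]

theorem earDet_vertex_nonpos_iff :
    ∀ i j : Fin 13, earDet i (vertexX j : ℤ) (vertexY j : ℤ) ≤ 0 ↔ j ≠ i := by
  decide

theorem prime_vertexX (i : Fin 13) : (vertexX i).Prime := by
  fin_cases i <;> norm_num [vertexX]

theorem prime_vertexY (i : Fin 13) : (vertexY i).Prime := by
  fin_cases i <;> norm_num [vertexY]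

theorem vertex_mem_cutHalfPlane_iff (i j : Fin 13) :
    ![(vertexX j : ℝ), (vertexY j : ℝ)] ∈ cutHalfPlane i ↔ j ≠ i := by
  rw [natCast_mem_cutHalfPlane_iff, earDet_vertex_nonpos_iff]

theorem cutHalfPlane_injective : Function.Injective cutHalfPlane := by
  intro i j h
  by_contra hij
  have := (vertex_mem_cutHalfPlane_iff j i).2 hij
  rw [← h, vertex_mem_cutHalfPlane_iff] at this
  exact this rfl

theorem exists_earDet_pos_of_prime {q r : ℕ} (hq : q.Prime) (hr : r.Prime) :
    ∃ i, 0 < earDet i (q : ℤ) (r : ℤ) := by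
  by_contra! h
  have h0 := h 0
  have h1 := h 1
  have h2 := h 2
  have h3 := h 3
  have h4 := h 4
  have h5 := h 5
  have h6 := h 6
  have h7 := h 7
  have h8 := h 8
  have h9 := h 9
  have h10 := h 10
  have h11 := h 11
  have h12 := h 12
  clear h
  simp [earDet, vertexX, vertexY] at h0 h1 h2 h3 h4 h5 h6 h7 h8 h9 h10 h11 h12
  have hlo : 881 ≤ q := by zify; linarith
  have hhi : q ≤ 941 := by zify; linarith
  have hr_hi : r ≤ 1301 := by zify; linarith
  interval_cases q <;> first
    | (exfalso; revert hq; norm_num; done)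
    | (interval_cases r <;> first
        | omega
        | (revert hr; norm_num))

/-- `H(𝒫 × 𝒫) ≥ 13`, where `𝒫 ⊆ ℝ` is the set of primes: `12` is not a Helly bound for
`𝒫 × 𝒫 ⊆ ℝ²`. -/
theorem primes_squared_helly_lower_bound :
    ¬ HellyBound 2 {z : Fin 2 → ℝ |
      (∃ q : ℕ, q.Prime ∧ z 0 = (q : ℝ)) ∧ (∃ q : ℕ, q.Prime ∧ z 1 = (q : ℝ))} 12 := by
  classical
  intro H
  obtain ⟨p, ⟨⟨q, hq, hpq⟩, r, hr, hpr⟩, hp⟩ := H (Finset.univ.image cutHalfPlane)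
    (by simpa using convex_cutHalfPlane) (by
      intro G hG hcard
      obtain ⟨j, hj⟩ : ∃ j, cutHalfPlane j ∉ G := by
        by_contra! h
        have := Finset.card_le_card (Finset.image_subset_iff.2 fun i (_ : i ∈ Finset.univ) => h i)
        rw [Finset.card_image_of_injective _ cutHalfPlane_injective, Finset.card_fin] at this
        omega
      refine ⟨![vertexX j, vertexY j],
        ⟨⟨_, prime_vertexX j, rfl⟩, _, prime_vertexY j, rfl⟩, fun A hA => ?_⟩
      obtain ⟨i, -, rfl⟩ := Finset.mem_image.1 (hG hA)
      exact (vertex_mem_cutHalfPlane_iff i j).2 fun hji => hj (hji ▸ hA))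
  obtain ⟨i, hi⟩ := exists_earDet_pos_of_prime hq hr
  refine hi.not_ge ((natCast_mem_cutHalfPlane_iff i q r).1 ?_)
  have := hp _ (Finset.mem_image_of_mem _ (Finset.mem_univ i))
  simpa [cutHalfPlane, hpq, hpr] using this
end
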